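/- GNFO ≰_𝒦 UCPDL⁺: the GNFO formula φ(x) = ∃y (a(x,y) ∧ ¬b(x,y)), for binary relation names a, b, is not expressible in UCPDL⁺, i.e. there is no UCPDL⁺ formula ψ such that for every Kripke structure K and every u ∈ dom(K), K,u ⊨ ψ iff K ⊨ φ[x ↦ u]. A witnessing pair: K with dom(K) = {u}, a^K = b^K = {(u,u)}, and K' with dom(K') = {u',v'}, a^{K'} = {(u',u'),(u',v'),(v',v')}, b^{K'} = {(u',u'),(v',v')}; K,u and K',u' satisfy exactly the same UCPDL⁺ formulas, yet K ⊭ φ[x↦u] while K' ⊨ φ[x↦u']. -/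

import Mathlib

namespace PaperCPDL

/-- Relational structures over a fixed countably infinite signature:
for every arity `n` there are countably many relation names, indexed by `ℕ`. -/
structure Struct : Type 1 where
  World : Type
  rel : (n : ℕ) → ℕ → (Fin n → World) → Prop

namespace Struct

variable (K : Struct)

/-- Atomic propositions are the unary relation names. -/
def prop (p : ℕ) (w : K.World) : Prop := K.rel 1 p fun _ => w

/-- Atomic programs are the binary relation names. -/
def prog (a : ℕ) (u v : K.World) : Prop :=
  K.rel 2 a fun i => if (i : ℕ) = 0 then u else v

/-- A Kripke structure interprets every relation of arity `> 2` as the empty relation. -/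
def IsKripke : Prop := ∀ n, 2 < n → ∀ r (t : Fin n → K.World), ¬ K.rel n r t

/-- Gaifman adjacency: `u` and `v` occur together in a tuple of some relation. -/
def gadj (u v : K.World) : Prop :=
  ∃ (n r : ℕ) (t : Fin n → K.World), K.rel n r t ∧ (∃ i, t i = u) ∧ ∃ j, t j = v

/-- distance at most 1 in the Gaifman graph. -/
def near (u v : K.World) : Prop := u = v ∨ K.gadj u v

/-- same connected component of the Gaifman graph. -/
def sameComp (u v : K.World) : Prop := Relation.ReflTransGen K.gadj u v

/-- finite degree: every world has finitely many Gaifman-neighbours. -/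
def FiniteDegree : Prop := ∀ u, {v | K.gadj u v}.Finite

end Struct

/-- r-atoms `R(x₁,…,xₙ)`: a relation name with its argument variables. -/
structure RAtom where
  name : ℕ
  args : List ℕ

mutual
  /-- Formulas of (U)CPDL⁺ (together with `loop` and program intersection,
  used to carve out the various fragments). -/
  inductive Fml : Type where
    | prop : ℕ → Fml
    | neg : Fml → Fml
    | and : Fml → Fml → Fml
    | diam : Prog → Fml
    | loop : Prog → Fml
  /-- Programs. -/
  inductive Prog : Type where
    | eps : Prog
    | atom : ℕ → Prog
    | conv : ℕ → Prog
    | union : Prog → Prog → Prog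
    | comp : Prog → Prog → Prog
    | star : Prog → Prog
    | test : Fml → Prog
    | inter : Prog → Prog → Prog
    | univ : Prog
    | cq : PList → List RAtom → ℕ → ℕ → Prog
  /-- Finite lists of p-atoms `π(x,y)`. -/
  inductive PList : Type where
    | nil : PList
    | cons : Prog → ℕ → ℕ → PList → PList
end

/-- satisfaction of an r-atom under an assignment. -/
def Struct.ratomSat (K : Struct) (f : ℕ → K.World) (r : RAtom) : Prop :=
  K.rel r.args.length r.name fun i => f (r.args.get i)

mutual
  /-- semantics of formulas. -/
  def evalF (K : Struct) : Fml → K.World → Prop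
    | .prop p, w => K.prop p w
    | .neg φ, w => ¬ evalF K φ w
    | .and φ ψ, w => evalF K φ w ∧ evalF K ψ w
    | .diam π, w => ∃ v, evalP K π w v
    | .loop π, w => evalP K π w w
  /-- semantics of programs. -/
  def evalP (K : Struct) : Prog → K.World → K.World → Prop
    | .eps, u, v => u = v
    | .atom a, u, v => K.prog a u v
    | .conv a, u, v => K.prog a v u
    | .union π₁ π₂, u, v => evalP K π₁ u v ∨ evalP K π₂ u v
    | .comp π₁ π₂, u, v => ∃ w, evalP K π₁ u w ∧ evalP K π₂ w v
    | .star π, u, v => Relation.ReflTransGen (fun a b => evalP K π a b) u v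
    | .test φ, u, v => u = v ∧ evalF K φ u
    | .inter π₁ π₂, u, v => evalP K π₁ u v ∧ evalP K π₂ u v
    | .univ, _, _ => True
    | .cq ps rs xs xt, u, v =>
        ∃ f : ℕ → K.World, f xs = u ∧ f xt = v ∧ evalPL K f ps ∧ ∀ r ∈ rs, K.ratomSat f r
  /-- semantics of a list of p-atoms. -/
  def evalPL (K : Struct) (f : ℕ → K.World) : PList → Prop
    | .nil => True
    | .cons π x y ps => evalP K π (f x) (f y) ∧ evalPL K f ps
end

/-! ## Conjunctive programs: variables, underlying graph, well-formedness -/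

/-- variables occurring in a list of p-atoms. -/
def PList.vars : PList → List ℕ
  | .nil => []
  | .cons _ x y ps => x :: y :: ps.vars

/-- variables of a conjunctive program given by p-atoms `ps` and r-atoms `rs`. -/
def cqVars (ps : PList) (rs : List RAtom) : List ℕ :=
  ps.vars ++ (rs.map RAtom.args).flatten

/-- co-occurrence of two variables in a p-atom of the list. -/
def PList.coOcc (x y : ℕ) : PList → Prop
  | .nil => False
  | .cons _ a b ps => ((x = a ∨ x = b) ∧ (y = a ∨ y = b)) ∨ PList.coOcc x y ps

/-- adjacency in the graph `G_C`: co-occurrence of two variables in some atom. -/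
def atomAdj (ps : PList) (rs : List RAtom) (x y : ℕ) : Prop :=
  ps.coOcc x y ∨ ∃ r ∈ rs, x ∈ r.args ∧ y ∈ r.args

/-- adjacency in the underlying graph of `C[x_s,x_t]`: `G_C` plus the edge `{x_s,x_t}`. -/
def ugAdj (ps : PList) (rs : List RAtom) (xs xt : ℕ) (x y : ℕ) : Prop :=
  atomAdj ps rs x y ∨ (x = xs ∧ y = xt) ∨ (x = xt ∧ y = xs)

/-- base well-formedness of a conjunctive program `C[x_s,x_t]`:
`x_s,x_t ∈ Vars(C)`, every r-atom has arity `> 2`, and `G_C` is connected. -/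
def cqWF (ps : PList) (rs : List RAtom) (xs xt : ℕ) : Prop :=
  xs ∈ cqVars ps rs ∧ xt ∈ cqVars ps rs ∧
  (∀ r ∈ rs, 2 < r.args.length) ∧
  ∀ x ∈ cqVars ps rs, ∀ y ∈ cqVars ps rs, Relation.ReflTransGen (atomAdj ps rs) x y

/-! ## Tree decompositions and tree-width -/

/-- A tree decomposition of the graph with vertex set `V` and adjacency `adj`. -/
structure TreeDecomp {α : Type} (V : Set α) (adj : α → α → Prop) where
  /-- the nodes of the tree -/
  B : Type
  /-- the tree -/
  tree : SimpleGraph B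
  isTree : tree.IsTree
  /-- the bags -/
  bag : B → Set α
  cover_vert : ∀ v ∈ V, ∃ b, v ∈ bag b
  cover_edge : ∀ u v, adj u v → ∃ b, u ∈ bag b ∧ v ∈ bag b
  bags_conn : ∀ (v : α) (b₁ b₂ : B), v ∈ bag b₁ → v ∈ bag b₂ →
      ∃ p : tree.Walk b₁ b₂, ∀ x ∈ p.support, v ∈ bag x

/-- the width of a tree decomposition is at most `k`. -/
def TreeDecomp.WidthLE {α : Type} {V : Set α} {adj : α → α → Prop}
    (td : TreeDecomp V adj) (k : ℕ) : Prop :=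
  ∀ b, (td.bag b).Finite ∧ (td.bag b).ncard ≤ k + 1

/-- the graph `(V, adj)` has tree-width at most `k`. -/
def TreewidthLE {α : Type} (V : Set α) (adj : α → α → Prop) (k : ℕ) : Prop :=
  ∃ td : TreeDecomp V adj, td.WidthLE k

/-- the Gaifman graph of the structure `K` has tree-width at most `k`. -/
def Struct.twLE (K : Struct) (k : ℕ) : Prop :=
  TreewidthLE (Set.univ : Set K.World) K.gadj k

/-- A good tree decomposition: along every tree edge one bag contains the other,
and the tree is binary (it has a root of degree `≤ 2`, all other nodes have degree `≤ 3`). -/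
def TreeDecomp.Good {α : Type} {V : Set α} {adj : α → α → Prop} (td : TreeDecomp V adj) : Prop :=
  (∀ b b', td.tree.Adj b b' → td.bag b ⊆ td.bag b' ∨ td.bag b' ⊆ td.bag b) ∧
  ∃ r : td.B, ∀ b, {b' | td.tree.Adj b b'}.Finite ∧
    ((b = r → {b' | td.tree.Adj b b'}.ncard ≤ 2) ∧ (b ≠ r → {b' | td.tree.Adj b b'}.ncard ≤ 3))

/-! ## Fragments -/

/-- all p-atoms of the list are of the form `π(x,x)` for the fixed variable `x`. -/
def PList.allOn (x : ℕ) : PList → Prop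
  | .nil => True
  | .cons _ a b ps => a = x ∧ b = x ∧ PList.allOn x ps

/-- A fragment specification: which of `loop`, `∩`, `U` are allowed, and which
shapes of conjunctive programs are allowed. -/
structure Frag where
  loopOK : Prop
  interOK : Prop
  univOK : Prop
  cqOK : PList → List RAtom → ℕ → ℕ → Prop

mutual
  /-- the formula belongs to the fragment `F`. -/
  def Fml.In : Frag → Fml → Prop
    | _, .prop _ => True
    | F, .neg φ => Fml.In F φ
    | F, .and φ ψ => Fml.In F φ ∧ Fml.In F ψ
    | F, .diam π => Prog.In F π
    | F, .loop π => F.loopOK ∧ Prog.In F π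
  /-- the program belongs to the fragment `F`. -/
  def Prog.In : Frag → Prog → Prop
    | _, .eps => True
    | _, .atom _ => True
    | _, .conv _ => True
    | F, .union π₁ π₂ => Prog.In F π₁ ∧ Prog.In F π₂
    | F, .comp π₁ π₂ => Prog.In F π₁ ∧ Prog.In F π₂
    | F, .star π => Prog.In F π
    | F, .test φ => Fml.In F φ
    | F, .inter π₁ π₂ => F.interOK ∧ Prog.In F π₁ ∧ Prog.In F π₂
    | F, .univ => F.univOK
    | F, .cq ps rs xs xt => F.cqOK ps rs xs xt ∧ cqWF ps rs xs xt ∧ PList.In F ps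
  /-- all programs of the list belong to the fragment `F`. -/
  def PList.In : Frag → PList → Prop
    | _, .nil => True
    | F, .cons π _ _ ps => Prog.In F π ∧ PList.In F ps
end

/-- CPDL: PDL with converse. -/
def Frag.cpdl : Frag := ⟨False, False, False, fun _ _ _ _ => False⟩
/-- ICPDL: CPDL with program intersection. -/
def Frag.icpdl : Frag := ⟨False, True, False, fun _ _ _ _ => False⟩
/-- loop-CPDL: CPDL with `loop(π)` formulas. -/
def Frag.loopCpdl : Frag := ⟨True, False, False, fun _ _ _ _ => False⟩
/-- CPDL⁺: CPDL with conjunctive programs. -/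
def Frag.cpdlPlus : Frag := ⟨False, False, False, fun _ _ _ _ => True⟩
/-- UCPDL⁺: CPDL⁺ with the universal program. -/
def Frag.ucpdlPlus : Frag := ⟨False, False, True, fun _ _ _ _ => True⟩
/-- CPDL⁺(TW_k): conjunctive programs with underlying graph of tree-width `≤ k`. -/
def Frag.tw (k : ℕ) : Frag :=
  ⟨False, False, False, fun ps rs xs xt =>
    TreewidthLE {x | x ∈ cqVars ps rs} (ugAdj ps rs xs xt) k⟩
/-- UCPDL⁺(TW_k). -/
def Frag.utw (k : ℕ) : Frag :=
  ⟨False, False, True, fun ps rs xs xt =>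
    TreewidthLE {x | x ∈ cqVars ps rs} (ugAdj ps rs xs xt) k⟩
/-- CPDL⁺(𝒢↺): the only conjunctive programs are `C[x,x]` where all atoms
are p-atoms of the form `π(x,x)`. -/
def Frag.gloop : Frag :=
  ⟨False, False, False, fun ps rs xs xt => xt = xs ∧ rs = [] ∧ PList.allOn xs ps⟩
/-- ICPDL⁺(TW₂): CPDL⁺(TW₂) together with program intersection. -/
def Frag.icpdlPlusTw2 : Frag :=
  ⟨False, True, False, fun ps rs xs xt =>
    TreewidthLE {x | x ∈ cqVars ps rs} (ugAdj ps rs xs xt) 2⟩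

mutual
  /-- positive formulas: no occurrence of negation. -/
  def Fml.Positive : Fml → Prop
    | .prop _ => True
    | .neg _ => False
    | .and φ ψ => Fml.Positive φ ∧ Fml.Positive ψ
    | .diam π => Prog.Positive π
    | .loop π => Prog.Positive π
  /-- positive programs. -/
  def Prog.Positive : Prog → Prop
    | .eps => True
    | .atom _ => True
    | .conv _ => True
    | .union π₁ π₂ => Prog.Positive π₁ ∧ Prog.Positive π₂
    | .comp π₁ π₂ => Prog.Positive π₁ ∧ Prog.Positive π₂
    | .star π => Prog.Positive π
    | .test φ => Fml.Positive φ
    | .inter π₁ π₂ => Prog.Positive π₁ ∧ Prog.Positive π₂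
    | .univ => True
    | .cq ps _ _ _ => PList.Positive ps
  /-- positive p-atom lists. -/
  def PList.Positive : PList → Prop
    | .nil => True
    | .cons π _ _ ps => Prog.Positive π ∧ PList.Positive ps
end

/-- the structure on `W` whose only nonempty relation is the binary relation
named `0`, interpreted as `e`. -/
def Struct.ofEdge (W : Type) (e : W → W → Prop) : Struct where
  World := W
  rel n r t := n = 2 ∧ r = 0 ∧
    ∃ a b, e a b ∧ ∀ i : Fin n, t i = if (i : ℕ) = 0 then a else b

/-- the structure on `W` whose only nonempty relations are the binary relations
named `0` and `1`, interpreted as `ea` and `eb`. -/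
def Struct.ofEdges2 (W : Type) (ea eb : W → W → Prop) : Struct where
  World := W
  rel n r t := n = 2 ∧
    ((r = 0 ∧ ∃ a b, ea a b ∧ ∀ i : Fin n, t i = if (i : ℕ) = 0 then a else b) ∨
     (r = 1 ∧ ∃ a b, eb a b ∧ ∀ i : Fin n, t i = if (i : ℕ) = 0 then a else b))

/-- the one-point structure with `a = b = {(u,u)}` (`a`, `b` are the atomic
programs named `0` and `1`). -/
def K12 : Struct := Struct.ofEdges2 Unit (fun _ _ => True) fun _ _ => True

/-- the two-point structure on `{u',v'} = {false,true}` with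
`a = {(u',u'),(u',v'),(v',v')}` and `b = {(u',u'),(v',v')}`. -/
def K12' : Struct := Struct.ofEdges2 Bool (fun x y => x = false ∨ y = true) fun x y => x = y

/-- `h : L → K` is a homomorphism that has, through every world of `L`, a homomorphic section. -/
structure IsRetraction (K L : Struct) (h : L.World → K.World) : Prop where
  map_rel : ∀ n r (t : Fin n → L.World), L.rel n r t → K.rel n r fun i => h (t i)
  exists_section : ∀ w : L.World, ∃ s : K.World → L.World,
    (∀ n r (t : Fin n → K.World), K.rel n r t → L.rel n r fun i => s (t i)) ∧
    (∀ x, h (s x) = x) ∧ s (h w) = w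

theorem Struct.prog_map {K L : Struct} {h : L.World → K.World}
    (hh : ∀ n r (t : Fin n → L.World), L.rel n r t → K.rel n r fun i => h (t i))
    {a : ℕ} {u v : L.World} (huv : L.prog a u v) : K.prog a (h u) (h v) := by
  have := hh _ _ _ huv
  simpa only [Struct.prog, apply_ite h] using this

mutual
  /-- Formulas are invariant under retractions. -/
  theorem IsRetraction.evalF_iff {K L : Struct} {h : L.World → K.World}
      (hr : IsRetraction K L h) : ∀ (φ : Fml) (w : L.World), evalF L φ w ↔ evalF K φ (h w)
    | .prop p, w => by
        obtain ⟨s, hs, -, hw⟩ := hr.exists_section w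
        simp only [evalF, Struct.prop]
        refine ⟨fun H => hr.map_rel _ _ _ H, fun H => ?_⟩
        simpa only [hw] using hs _ _ _ H
    | .neg φ, w => by
        simp only [evalF, hr.evalF_iff φ w]
    | .and φ ψ, w => by
        simp only [evalF, hr.evalF_iff φ w, hr.evalF_iff ψ w]
    | .diam π, w => by
        obtain ⟨s, hs, hhs, hw⟩ := hr.exists_section w
        simp only [evalF]
        refine ⟨fun ⟨v, hv⟩ => ⟨h v, hr.evalP_map π w v hv⟩, fun ⟨v, hv⟩ => ⟨s v, ?_⟩⟩
        simpa only [hw] using hr.evalP_section s hs hhs π _ _ hv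
    | .loop π, w => by
        obtain ⟨s, hs, hhs, hw⟩ := hr.exists_section w
        simp only [evalF]
        refine ⟨hr.evalP_map π w w, fun H => ?_⟩
        simpa only [hw] using hr.evalP_section s hs hhs π _ _ H
  /-- Retractions preserve programs. -/
  theorem IsRetraction.evalP_map {K L : Struct} {h : L.World → K.World}
      (hr : IsRetraction K L h) :
      ∀ (π : Prog) (u v : L.World), evalP L π u v → evalP K π (h u) (h v)
    | .eps, u, v => by
        simp only [evalP]; exact congrArg h
    | .atom a, u, v => by
        simp only [evalP]; exact Struct.prog_map hr.map_rel
    | .conv a, u, v => by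
        simp only [evalP]; exact Struct.prog_map hr.map_rel
    | .union π₁ π₂, u, v => by
        simp only [evalP]
        exact Or.imp (hr.evalP_map π₁ u v) (hr.evalP_map π₂ u v)
    | .comp π₁ π₂, u, v => by
        simp only [evalP]
        exact fun ⟨w, h₁, h₂⟩ => ⟨h w, hr.evalP_map π₁ u w h₁, hr.evalP_map π₂ w v h₂⟩
    | .star π, u, v => by
        simp only [evalP]
        exact fun H => H.lift h fun a b hab => hr.evalP_map π a b hab
    | .test φ, u, v => by
        simp only [evalP, hr.evalF_iff φ u]
        exact And.imp_left (congrArg h)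
    | .inter π₁ π₂, u, v => by
        simp only [evalP]
        exact And.imp (hr.evalP_map π₁ u v) (hr.evalP_map π₂ u v)
    | .univ, u, v => by
        simp only [evalP, imp_self]
    | .cq ps rs xs xt, u, v => by
        simp only [evalP]
        rintro ⟨f, rfl, rfl, hps, hrs⟩
        exact ⟨fun x => h (f x), rfl, rfl, hr.evalPL_map ps f hps,
          fun r hmem => hr.map_rel _ _ _ (hrs r hmem)⟩
  /-- Retractions preserve lists of p-atoms. -/
  theorem IsRetraction.evalPL_map {K L : Struct} {h : L.World → K.World}
      (hr : IsRetraction K L h) :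
      ∀ (ps : PList) (f : ℕ → L.World), evalPL L f ps → evalPL K (fun x => h (f x)) ps
    | .nil, f => by
        simp only [evalPL, imp_self]
    | .cons π x y ps, f => by
        simp only [evalPL]
        exact And.imp (hr.evalP_map π _ _) (hr.evalPL_map ps f)
  /-- Homomorphic sections of retractions preserve programs. -/
  theorem IsRetraction.evalP_section {K L : Struct} {h : L.World → K.World}
      (hr : IsRetraction K L h) (s : K.World → L.World)
      (hs : ∀ n r (t : Fin n → K.World), K.rel n r t → L.rel n r fun i => s (t i))
      (hhs : ∀ x, h (s x) = x) :
      ∀ (π : Prog) (u v : K.World), evalP K π u v → evalP L π (s u) (s v)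
    | .eps, u, v => by
        simp only [evalP]; exact congrArg s
    | .atom a, u, v => by
        simp only [evalP]; exact Struct.prog_map hs
    | .conv a, u, v => by
        simp only [evalP]; exact Struct.prog_map hs
    | .union π₁ π₂, u, v => by
        simp only [evalP]
        exact Or.imp (hr.evalP_section s hs hhs π₁ u v) (hr.evalP_section s hs hhs π₂ u v)
    | .comp π₁ π₂, u, v => by
        simp only [evalP]
        exact fun ⟨w, h₁, h₂⟩ =>
          ⟨s w, hr.evalP_section s hs hhs π₁ u w h₁, hr.evalP_section s hs hhs π₂ w v h₂⟩
    | .star π, u, v => by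
        simp only [evalP]
        exact fun H => H.lift s fun a b hab => hr.evalP_section s hs hhs π a b hab
    | .test φ, u, v => by
        simp only [evalP, hr.evalF_iff φ (s u), hhs]
        exact And.imp_left (congrArg s)
    | .inter π₁ π₂, u, v => by
        simp only [evalP]
        exact And.imp (hr.evalP_section s hs hhs π₁ u v) (hr.evalP_section s hs hhs π₂ u v)
    | .univ, u, v => by
        simp only [evalP, imp_self]
    | .cq ps rs xs xt, u, v => by
        simp only [evalP]
        rintro ⟨f, rfl, rfl, hps, hrs⟩
        exact ⟨fun x => s (f x), rfl, rfl, hr.evalPL_section s hs hhs ps f hps,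
          fun r hmem => hs _ _ _ (hrs r hmem)⟩
  /-- Homomorphic sections of retractions preserve lists of p-atoms. -/
  theorem IsRetraction.evalPL_section {K L : Struct} {h : L.World → K.World}
      (hr : IsRetraction K L h) (s : K.World → L.World)
      (hs : ∀ n r (t : Fin n → K.World), K.rel n r t → L.rel n r fun i => s (t i))
      (hhs : ∀ x, h (s x) = x) :
      ∀ (ps : PList) (f : ℕ → K.World), evalPL K f ps → evalPL L (fun x => s (f x)) ps
    | .nil, f => by
        simp only [evalPL, imp_self]
    | .cons π x y ps, f => by
        simp only [evalPL]
        exact And.imp (hr.evalP_section s hs hhs π _ _) (hr.evalPL_section s hs hhs ps f)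
end

namespace Struct

variable {V W : Type} {ea eb : W → W → Prop} {fa fb : V → V → Prop}

theorem ofEdges2_isKripke (W : Type) (ea eb : W → W → Prop) : (ofEdges2 W ea eb).IsKripke := by
  rintro n hn r t ⟨rfl, -⟩
  exact lt_irrefl _ hn

theorem ofEdges2_map (g : V → W) (ha : ∀ x y, fa x y → ea (g x) (g y))
    (hb : ∀ x y, fb x y → eb (g x) (g y)) (n r : ℕ) (t : Fin n → V)
    (ht : (ofEdges2 V fa fb).rel n r t) : (ofEdges2 W ea eb).rel n r fun i => g (t i) := by
  obtain ⟨hn, ⟨hr, x, y, hxy, h⟩ | ⟨hr, x, y, hxy, h⟩⟩ := ht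
  · exact ⟨hn, .inl ⟨hr, g x, g y, ha x y hxy,
      fun i => (congrArg g (h i)).trans (apply_ite g _ _ _)⟩⟩
  · exact ⟨hn, .inr ⟨hr, g x, g y, hb x y hxy,
      fun i => (congrArg g (h i)).trans (apply_ite g _ _ _)⟩⟩

theorem ofEdges2_prog_zero (x y : W) : (ofEdges2 W ea eb).prog 0 x y ↔ ea x y := by
  refine ⟨?_, fun h => ⟨rfl, .inl ⟨rfl, x, y, h, fun _ => rfl⟩⟩⟩
  rintro ⟨-, ⟨-, a, b, hab, h⟩ | ⟨h, -⟩⟩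
  · obtain rfl : x = a := by simpa using h 0
    obtain rfl : y = b := by simpa using h 1
    exact hab
  · exact absurd h zero_ne_one

theorem ofEdges2_prog_one (x y : W) : (ofEdges2 W ea eb).prog 1 x y ↔ eb x y := by
  refine ⟨?_, fun h => ⟨rfl, .inr ⟨rfl, x, y, h, fun _ => rfl⟩⟩⟩
  rintro ⟨-, ⟨h, -⟩ | ⟨-, a, b, hab, h⟩⟩
  · exact absurd h one_ne_zero
  · obtain rfl : x = a := by simpa using h 0
    obtain rfl : y = b := by simpa using h 1
    exact hab

end Struct

theorem isRetraction_K12 : IsRetraction K12 K12' fun _ => () where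
  map_rel := Struct.ofEdges2_map (V := Bool) (W := Unit) (fun _ => ())
    (fun _ _ _ => trivial) fun _ _ _ => trivial
  exists_section w := ⟨fun _ => w,
    Struct.ofEdges2_map (V := Unit) (W := Bool) (fun _ => w)
      (fun _ _ _ => Bool.eq_false_or_eq_true w |>.symm) (fun _ _ _ => rfl),
    fun _ => rfl, rfl⟩

/-- GNFO ≰_𝒦 UCPDL⁺: the GNFO formula
`φ(x) = ∃y (a(x,y) ∧ ¬b(x,y))` is not expressible in UCPDL⁺; the pair `K12, K12'`
is a witness: `K12,u` and `K12',u'` satisfy the same UCPDL⁺ formulas, yet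
`K12 ⊭ φ[x↦u]` while `K12' ⊨ φ[x↦u']`. -/
theorem statement_12 :
    (¬ ∃ ψ : Fml, Fml.In Frag.ucpdlPlus ψ ∧
      ∀ K : Struct, K.IsKripke → ∀ u : K.World,
        (evalF K ψ u ↔ ∃ y, K.prog 0 u y ∧ ¬ K.prog 1 u y)) ∧
    (∀ ψ : Fml, Fml.In Frag.ucpdlPlus ψ →
      (evalF K12 ψ (() : Unit) ↔ evalF K12' ψ (false : Bool))) ∧
    ¬ (∃ y : Unit, K12.prog 0 () y ∧ ¬ K12.prog 1 () y) ∧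
    (∃ y : Bool, K12'.prog 0 false y ∧ ¬ K12'.prog 1 false y) := by
  have hinv (ψ : Fml) : evalF K12 ψ (() : Unit) ↔ evalF K12' ψ (false : Bool) :=
    (isRetraction_K12.evalF_iff ψ (false : Bool)).symm
  have hK : ¬ ∃ y : Unit, K12.prog 0 () y ∧ ¬ K12.prog 1 () y := fun ⟨y, _, hy⟩ =>
    hy ((Struct.ofEdges2_prog_one () y).2 trivial)
  have hK' : ∃ y : Bool, K12'.prog 0 false y ∧ ¬ K12'.prog 1 false y :=
    ⟨true, (Struct.ofEdges2_prog_zero false true).2 (.inl rfl),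
      fun h => Bool.false_ne_true ((Struct.ofEdges2_prog_one false true).1 h)⟩
  refine ⟨fun ⟨ψ, _, hψ⟩ => hK ?_, fun ψ _ => hinv ψ, hK, hK'⟩
  exact (hψ K12 (Struct.ofEdges2_isKripke _ _ _) ()).1
    ((hinv ψ).2 ((hψ K12' (Struct.ofEdges2_isKripke _ _ _) false).2 hK'))

end PaperCPDL
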